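/- arXiv:1412.4296 — 5 statements merged into one kernel-verified Lean document; each statement's English description precedes it below -/
import Mathlib

section
/- For any boundedly-finite homogeneous metric space X, the factorizing step s(X) belongs to the set ss(X); that is, the infimum defining s(X) is attained. -/
open scoped ENNReal symmDiff

noncomputable section

/-- The supremum in `ℕ∞` of a set of natural numbers. -/
def natSup (s : Set ℕ) : ℕ∞ := sSup ((↑) '' s : Set ℕ∞)

/-- The `ε`-connected component of a point `x`: all points linkable to `x` by a chain with
consecutive distances `≤ ε` (for `ε = ∞` this is the whole space). -/
def comp (X : Type*) [MetricSpace X] (ε : ℝ≥0∞) (x : X) : Set X :=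
  {y | Relation.ReflTransGen (fun a b => edist a b ≤ ε) x y}

/-- `ss X` is the set of `ε ∈ [0,∞]` such that for every finite `δ ≥ ε` and every point `x` the
set `{X_ε(y) : y ∈ X_δ(x)}` of `ε`-components of points of `X_δ(x)` is finite. -/
def ssSet (X : Type*) [MetricSpace X] : Set ℝ≥0∞ :=
  {ε | ∀ δ : ℝ≥0∞, δ ≠ ⊤ → ε ≤ δ → ∀ x : X, ((comp X ε) '' (comp X δ x)).Finite}

/-- The factorizing step `s(X) = inf ss(X)`. -/
def sStep (X : Type*) [MetricSpace X] : ℝ≥0∞ := sInf (ssSet X)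

/-- A metric space is boundedly-finite if every bounded subset is finite. -/
def BoundedlyFinite (X : Type*) [MetricSpace X] : Prop :=
  ∀ s : Set X, Bornology.IsBounded s → s.Finite

/-- A metric space is homogeneous if for any two points there is a bijective self-isometry
moving one to the other. -/
def Homogeneous (X : Type*) [MetricSpace X] : Prop :=
  ∀ x y : X, ∃ f : X ≃ᵢ X, f x = y

/-- A subset `C` is large scale connected if any two of its points can be linked by an
`ε`-chain for a common finite `ε`. -/
def IsLSCSet {X : Type*} [MetricSpace X] (C : Set X) : Prop :=
  ∃ ε : ℝ≥0∞, ε ≠ ⊤ ∧ ∀ x ∈ C, ∀ y ∈ C, y ∈ comp X ε x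

/-- A metric space is large scale connected if it coincides with an `ε`-connected component
for some finite `ε`. -/
def LargeScaleConnected (X : Type*) [MetricSpace X] : Prop :=
  ∃ ε : ℝ≥0∞, ε ≠ ⊤ ∧ ∀ x y : X, y ∈ comp X ε x

/-- A metric space is shift-homogeneous if any point can be moved to any other point by a
bijective self-isometry whose displacement is bounded on each large scale connected subset. -/
def ShiftHomogeneous (X : Type*) [MetricSpace X] : Prop :=
  ∀ x y : X, ∃ f : X ≃ᵢ X, f x = y ∧
    ∀ C : Set X, IsLSCSet C → ∃ M : ℝ, ∀ c ∈ C, dist (f c) c ≤ M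

/-- The oscillation `ω_f(δ) = sup {d (f x) (f x') : d x x' ≤ δ}` of a map, in `[0,∞]`. -/
def osc {X Y : Type*} [MetricSpace X] [MetricSpace Y] (f : X → Y) (δ : ℝ≥0∞) : ℝ≥0∞ :=
  ⨆ (x : X) (x' : X) (_ : edist x x' ≤ δ), edist (f x) (f x')

/-- A map between metric spaces is coarse if its oscillation at each finite `δ` is finite. -/
def CoarseMapM {X Y : Type*} [MetricSpace X] [MetricSpace Y] (f : X → Y) : Prop :=
  ∀ δ : ℝ≥0∞, δ ≠ ⊤ → osc f δ ≠ ⊤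

/-- Two metric spaces are coarsely isomorphic if there is a bijection between them which is
coarse in both directions. -/
def CoarselyIsomorphic (X Y : Type*) [MetricSpace X] [MetricSpace Y] : Prop :=
  ∃ f : X ≃ Y, CoarseMapM ⇑f ∧ CoarseMapM ⇑f.symm

/-- Two metric spaces are coarsely equivalent if there are coarse maps in both directions whose
compositions are within finite distance of the identities. -/
def CoarselyEquivalent (X Y : Type*) [MetricSpace X] [MetricSpace Y] : Prop :=
  ∃ f : X → Y, CoarseMapM f ∧ ∃ g : Y → X, CoarseMapM g ∧
    (∃ M : ℝ, ∀ x : X, dist x (g (f x)) ≤ M) ∧ (∃ M : ℝ, ∀ y : Y, dist y (f (g y)) ≤ M)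

/-- A metric on a group is left-invariant if left translations are isometries. -/
def LeftInvariantMetric (G : Type*) [Group G] [MetricSpace G] : Prop :=
  ∀ g x y : G, dist (g * x) (g * y) = dist x y

/-- A metric on a countable space is proper if all closed balls are finite. -/
def ProperMetric (X : Type*) [MetricSpace X] : Prop :=
  ∀ (x : X) (r : ℝ), (Metric.closedBall x r).Finite

theorem comp_mono {X : Type*} [MetricSpace X] {ε δ : ℝ≥0∞} (h : ε ≤ δ) (x : X) :
    comp X ε x ⊆ comp X δ x :=
  fun _ hy => Relation.ReflTransGen.mono (fun _ _ hab => le_trans hab h) _ _ hy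

/-- In a boundedly-finite homogeneous space, just above any finite `s` there is a gap in the set
of distances. -/
theorem exists_gap_edist {X : Type*} [MetricSpace X] (hb : BoundedlyFinite X)
    (hh : Homogeneous X) {s : ℝ≥0∞} (hs : s ≠ ⊤) :
    ∃ t, s < t ∧ ∀ a b : X, edist a b < t → edist a b ≤ s := by
  rcases isEmpty_or_nonempty X with hX | ⟨⟨x⟩⟩
  · exact ⟨⊤, hs.lt_top, fun a => (hX.false a).elim⟩
  have hs1 : s < s + 1 := ENNReal.lt_add_right hs one_ne_zero
  have hfin : (Metric.closedEBall x (s + 1)).Finite := by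
    apply hb
    rw [Metric.isBounded_iff_ediam_ne_top]
    refine (Metric.ediam_closedEBall_le.trans_lt ?_).ne
    exact ENNReal.mul_lt_top (by simp) (by simp [hs.lt_top])
  have hev : ∀ᶠ t in nhdsWithin s (Set.Ioi s),
      ∀ y ∈ Metric.closedEBall x (s + 1), edist y x < t → edist y x ≤ s := by
    rw [Filter.eventually_all_finite hfin]
    intro y _
    rcases le_or_gt (edist y x) s with hy | hy
    · exact .of_forall fun _ _ => hy
    · filter_upwards [Ioo_mem_nhdsGT hy] with t ht hyt
      exact absurd hyt ht.2.not_gt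
  have : (nhdsWithin s (Set.Ioi s)).NeBot := nhdsGT_neBot_of_exists_gt ⟨_, hs1⟩
  obtain ⟨t, ht, hst, hts⟩ := (hev.and (Ioo_mem_nhdsGT hs1)).exists
  refine ⟨t, hst, fun a b hab => ?_⟩
  obtain ⟨f, hf⟩ := hh b x
  rw [← f.isometry.edist_eq a b, hf] at hab ⊢
  exact ht _ (hab.trans hts).le hab

/-- Proposition 3.2: for a boundedly-finite homogeneous metric space the infimum defining the
factorizing step is attained: `s(X) ∈ ss(X)`. -/
theorem sStep_mem_ssSet_of_boundedly_finite_homogeneous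
    (X : Type*) [MetricSpace X] (hb : BoundedlyFinite X) (hh : Homogeneous X) :
    sStep X ∈ ssSet X := by
  by_cases hs : sStep X = ⊤
  · intro δ hδ hle
    exact absurd (top_le_iff.mp (hs ▸ hle)) hδ
  obtain ⟨t, hst, ht⟩ := exists_gap_edist hb hh hs
  obtain ⟨ε, hε, hεt⟩ := sInf_lt_iff.mp hst
  have hcomp : comp X (sStep X) = comp X ε := by
    funext x
    refine (comp_mono (sInf_le hε) x).antisymm fun y hy => ?_
    exact Relation.ReflTransGen.mono (fun a b hab => ht a b (lt_of_le_of_lt hab hεt)) _ _ hy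
  intro δ hδ _ x
  rw [hcomp]
  exact (hε (max δ ε) (max_lt hδ.lt_top hεt.lt_top).ne (le_max_right _ _) x).subset
    (Set.image_mono (comp_mono (le_max_left _ _) x))

end
end

section
/- Every amenable metric space X admits a finitely additive probability measure μ defined on the family of all subsets of X which is invariant in the sense that μ(f(A)) = μ(A) for every subset A ⊆ X and every bijection f : X → X with sup_{x∈X} d(f(x),x) < ∞. -/
open scoped ENNReal symmDiff

noncomputable section

/-- A metric space is amenable if for every `c > 1` and finite `ε > 0` there is a nonempty
finite set `F` whose closed `ε`-neighbourhood `O_ε(F)` is finite of cardinality `≤ c * |F|`. -/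
def AmenableSpace (X : Type*) [MetricSpace X] : Prop :=
  ∀ c : ℝ, 1 < c → ∀ ε : ℝ, 0 < ε → ∃ F : Finset X, F.Nonempty ∧
    {x : X | ∃ y ∈ F, dist x y ≤ ε}.Finite ∧
    ({x : X | ∃ y ∈ F, dist x y ≤ ε}.ncard : ℝ) ≤ c * F.card

/-- The proportion of the points of a finite set `F` that lie in `A`. -/
def relDensity {X : Type*} (F : Finset X) (A : Set X) : ℝ :=
  ((A ∩ F).ncard : ℝ) / F.card

section RelDensity

variable {X : Type*} (F : Finset X)

theorem relDensity_mem_Icc (A : Set X) : relDensity F A ∈ Set.Icc (0 : ℝ) 1 := by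
  refine ⟨by unfold relDensity; positivity, div_le_one_of_le₀ ?_ (by positivity)⟩
  have hle := Set.ncard_le_ncard (Set.inter_subset_right (s := A)) F.finite_toSet
  rw [Set.ncard_coe_finset] at hle
  exact_mod_cast hle

theorem relDensity_univ (hF : F.Nonempty) : relDensity F Set.univ = 1 := by
  have hcard : (F.card : ℝ) ≠ 0 := by exact_mod_cast hF.card_pos.ne'
  simp [relDensity, Set.ncard_coe_finset, hcard]

theorem relDensity_union {A B : Set X} (hAB : Disjoint A B) :
    relDensity F (A ∪ B) = relDensity F A + relDensity F B := by
  unfold relDensity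
  rw [Set.union_inter_distrib_right,
    Set.ncard_union_eq (hAB.mono Set.inter_subset_left Set.inter_subset_left)
      (F.finite_toSet.inter_of_right A) (F.finite_toSet.inter_of_right B)]
  push_cast
  ring

/-- If the `ε`-neighbourhood of `F` has at most `(1 + η) |F|` points, an injective map of
displacement at most `ε` increases relative densities in `F` by at most `η`. -/
theorem relDensity_image_le [MetricSpace X] (hF : F.Nonempty) {ε η : ℝ} (hε : 0 ≤ ε)
    (hfin : {x : X | ∃ y ∈ F, dist x y ≤ ε}.Finite)
    (hcard : ({x : X | ∃ y ∈ F, dist x y ≤ ε}.ncard : ℝ) ≤ (1 + η) * F.card)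
    {f : X → X} (hf : Function.Injective f) (hdist : ∀ x, dist (f x) x ≤ ε) (A : Set X) :
    relDensity F (f '' A) ≤ relDensity F A + η := by
  set N : Set X := {x : X | ∃ y ∈ F, dist x y ≤ ε}
  have hFN : (F : Set X) ⊆ N := fun x hx ↦ ⟨x, hx, by simpa using hε⟩
  have hpre : A ∩ f ⁻¹' F ⊆ (A ∩ F) ∪ (N \ F) := by
    rintro x ⟨hxA, hxF⟩
    by_cases hx : x ∈ (F : Set X)
    · exact Or.inl ⟨hxA, hx⟩
    · exact Or.inr ⟨⟨f x, hxF, by rw [dist_comm]; exact hdist x⟩, hx⟩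
  have himage : (f '' A ∩ F).ncard ≤ (A ∩ F).ncard + (N \ F).ncard := by
    rw [← Set.image_inter_preimage, Set.ncard_image_of_injective _ hf]
    exact (Set.ncard_le_ncard hpre
      ((F.finite_toSet.inter_of_right A).union hfin.sdiff)).trans (Set.ncard_union_le _ _)
  have hdiff : ((N \ F).ncard : ℝ) + F.card = N.ncard := by
    rw [← Set.ncard_coe_finset F]
    exact_mod_cast Set.ncard_sdiff_add_ncard_of_subset hFN hfin
  have hpos : (0 : ℝ) < F.card := by exact_mod_cast hF.card_pos
  unfold relDensity
  rw [div_add' _ _ _ hpos.ne', div_le_div_iff_of_pos_right hpos]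
  have himage' : ((f '' A ∩ F).ncard : ℝ) ≤ (A ∩ F).ncard + (N \ F).ncard := by
    exact_mod_cast himage
  linarith

end RelDensity

/-- Finitely additive set functions of total mass one that do not increase under a bijection
are invariant under it. -/
theorem image_eq_of_forall_image_le {X : Type*} {μ : Set X → ℝ}
    (hadd : ∀ A B : Set X, Disjoint A B → μ (A ∪ B) = μ A + μ B)
    {f : X → X} (hf : Function.Bijective f) (hle : ∀ A, μ (f '' A) ≤ μ A) (A : Set X) :
    μ (f '' A) = μ A := by
  refine le_antisymm (hle A) ?_
  have hA := hadd A Aᶜ disjoint_compl_right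
  have hfA := hadd (f '' A) (f '' A)ᶜ disjoint_compl_right
  have hcompl := hle Aᶜ
  rw [Set.union_compl_self] at hA hfA
  rw [Set.image_compl_eq hf] at hcompl
  linarith

/-- Proposition 7.1: every amenable metric space carries a finitely additive probability
measure on all subsets, invariant under bijections at finite distance from the identity. -/
theorem amenable_space_admits_invariant_measure
    (X : Type*) [MetricSpace X] (h : AmenableSpace X) :
    ∃ μ : Set X → ℝ, (∀ A : Set X, 0 ≤ μ A ∧ μ A ≤ 1) ∧ μ Set.univ = 1 ∧
      (∀ A B : Set X, Disjoint A B → μ (A ∪ B) = μ A + μ B) ∧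
      ∀ f : X → X, Function.Bijective f → (∃ M : ℝ, ∀ x : X, dist (f x) x ≤ M) →
        ∀ A : Set X, μ (f '' A) = μ A := by
  have hseq (n : ℕ) := h (1 + 1 / ((n : ℝ) + 1))
    (lt_add_of_pos_right 1 Nat.one_div_pos_of_nat) ((n : ℝ) + 1) (by positivity)
  choose F hF hfin hcard using hseq
  have hlim (A : Set X) : ∃ m ∈ Set.Icc (0 : ℝ) 1,
      Filter.Tendsto (fun n ↦ relDensity (F n) A) (Filter.hyperfilter ℕ) (nhds m) :=
    isCompact_Icc.ultrafilter_le_nhds'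
      ((Filter.hyperfilter ℕ).map fun n ↦ relDensity (F n) A)
      (Filter.mem_map.2 (Filter.Eventually.of_forall fun n ↦ relDensity_mem_Icc (F n) A))
  choose μ hμ hμlim using hlim
  have hadd (A B : Set X) (hAB : Disjoint A B) : μ (A ∪ B) = μ A + μ B :=
    tendsto_nhds_unique (hμlim (A ∪ B)) <|
      ((hμlim A).add (hμlim B)).congr fun n ↦ (relDensity_union (F n) hAB).symm
  refine ⟨μ, hμ, ?_, hadd, ?_⟩
  · exact tendsto_nhds_unique (hμlim Set.univ) <|
      tendsto_const_nhds.congr fun n : ℕ ↦ (relDensity_univ (F n) (hF n)).symm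
  · rintro f hf ⟨M, hM⟩
    refine image_eq_of_forall_image_le hadd hf fun A ↦ ?_
    have hyper : (Filter.hyperfilter ℕ : Filter ℕ) ≤ Filter.atTop := Nat.hyperfilter_le_atTop
    have hsum := (hμlim A).add
      ((tendsto_one_div_add_atTop_nhds_zero_nat (𝕜 := ℝ)).mono_left hyper)
    rw [add_zero] at hsum
    refine le_of_tendsto_of_tendsto (hμlim (f '' A)) hsum (hyper ?_)
    filter_upwards [Filter.eventually_ge_atTop ⌈M⌉₊] with n hn
    have hMn : M ≤ (n : ℝ) + 1 := (Nat.ceil_le.1 hn).trans (by linarith)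
    exact relDensity_image_le (F n) (hF n) (by positivity) (hfin n) (hcard n) hf.injective
      (fun x ↦ (hM x).trans hMn) A

end
end

section
/- A countable group G endowed with a proper left-invariant metric d is amenable as a metric space if and only if G admits a right-invariant finitely additive probability measure defined on the family of all subsets of G. -/
open scoped ENNReal symmDiff

noncomputable section

section

open Filter Topology
open scoped Pointwise

/-- The closed neighbourhood `O_ε(F)` of a finite set in a group with left-invariant metric is
the product of `F` with the closed ball at the identity. -/
theorem LeftInvariantMetric.setOf_dist_le_eq_mul {G : Type*} [Group G] [MetricSpace G]
    [DecidableEq G] (hinv : LeftInvariantMetric G) (hproper : ProperMetric G) (F : Finset G)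
    (ε : ℝ) :
    {x : G | ∃ y ∈ F, dist x y ≤ ε} = ((F * (hproper 1 ε).toFinset : Finset G) : Set G) := by
  ext x
  simp only [Set.mem_ofPred_eq, Finset.mem_coe, Finset.mem_mul, Set.Finite.mem_toFinset,
    Metric.mem_closedBall]
  constructor
  · rintro ⟨y, hy, hxy⟩
    refine ⟨y, hy, y⁻¹ * x, ?_, by group⟩
    rw [← hinv y]
    simpa using hxy
  · rintro ⟨y, hy, z, hz, rfl⟩
    refine ⟨y, hy, ?_⟩
    simpa using (hinv y z 1).trans_le hz

/-- A bounded real-valued function converges along any ultrafilter. -/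
theorem Ultrafilter.tendsto_limUnder_of_mem_Icc {ι : Type*} (u : Ultrafilter ι) {f : ι → ℝ}
    {a b : ℝ} (hf : ∀ i, f i ∈ Set.Icc a b) : Tendsto f u (𝓝 (limUnder u f)) := by
  have hmem : Set.Icc a b ∈ u.map f := Ultrafilter.mem_map.2 (Filter.univ_mem' hf)
  obtain ⟨x, -, hx⟩ := isCompact_Icc.ultrafilter_le_nhds' (u.map f) hmem
  exact tendsto_nhds_limUnder ⟨x, hx⟩

/-- A sequence of nonempty finite sets which is asymptotically invariant under right translations
yields a right-invariant mean. -/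
theorem exists_right_invariant_measure_of_folner {G : Type*} [Group G] (F : ℕ → Finset G)
    (hF : ∀ n, (F n).Nonempty)
    (hfol : ∀ g : G, ∀ᶠ n : ℕ in atTop, ∀ A : Set G,
      (((fun x => x * g) '' A ∩ F n).ncard : ℝ) ≤
        (A ∩ F n).ncard + 1 / ((n : ℝ) + 1) * (F n).card) :
    ∃ μ : Set G → ℝ, (∀ A : Set G, 0 ≤ μ A ∧ μ A ≤ 1) ∧ μ Set.univ = 1 ∧
      (∀ A B : Set G, Disjoint A B → μ (A ∪ B) = μ A + μ B) ∧
      ∀ (A : Set G) (g : G), μ ((fun x => x * g) '' A) = μ A := by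
  have hpos : ∀ n, (0 : ℝ) < (F n).card := fun n => by exact_mod_cast (hF n).card_pos
  have hfin : ∀ (A : Set G) n, (A ∩ F n).Finite := fun A n =>
    (F n).finite_toSet.subset Set.inter_subset_right
  set u : Ultrafilter ℕ := hyperfilter ℕ
  have hu : (u : Filter ℕ) ≤ atTop := Nat.hyperfilter_le_atTop
  let f : Set G → ℕ → ℝ := fun A n => (A ∩ F n).ncard / (F n).card
  have hf : ∀ A n, f A n ∈ Set.Icc (0 : ℝ) 1 := fun A n => by
    refine ⟨by positivity, (div_le_one (hpos n)).2 ?_⟩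
    exact_mod_cast (Set.ncard_le_ncard Set.inter_subset_right (F n).finite_toSet).trans_eq
      (Set.ncard_coe_finset _)
  have hlim : ∀ A, Tendsto (f A) u (𝓝 (limUnder u (f A))) := fun A =>
    u.tendsto_limUnder_of_mem_Icc (hf A)
  have hle : ∀ (A : Set G) (g : G),
      limUnder u (f ((fun x => x * g) '' A)) ≤ limUnder u (f A) := by
    intro A g
    have hsum := (hlim A).add (tendsto_one_div_add_atTop_nhds_zero_nat (𝕜 := ℝ) |>.mono_left hu)
    rw [add_zero] at hsum
    refine le_of_tendsto_of_tendsto (hlim _) hsum ?_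
    filter_upwards [hu (hfol g)] with n hn
    rw [div_le_iff₀ (hpos n), add_mul, div_mul_cancel₀ _ (hpos n).ne']
    exact hn A
  refine ⟨fun A => limUnder u (f A), fun A => ?_, ?_, fun A B hAB => ?_, fun A g => ?_⟩
  · exact isClosed_Icc.mem_of_tendsto (hlim A) (Filter.Eventually.of_forall (hf A))
  · refine tendsto_nhds_unique (hlim _) (tendsto_const_nhds.congr fun n => ?_)
    simp [f, (hpos n).ne']
  · refine tendsto_nhds_unique (hlim _) (((hlim A).add (hlim B)).congr fun n => ?_)
    simp only [f]
    rw [Set.union_inter_distrib_right, Set.ncard_union_eq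
      (hAB.mono Set.inter_subset_left Set.inter_subset_left) (hfin A n) (hfin B n)]
    push_cast
    ring
  · refine le_antisymm (hle A g) ?_
    simpa only [Set.image_image, mul_inv_cancel_right, Set.image_id'] using
      hle ((fun x => x * g) '' A) g⁻¹

/-- A right-invariant finitely additive function is preserved by injective maps which are
piecewise right translations with finitely many pieces. -/
theorem measure_image_eq_of_inv_mul_mem {G : Type*} [Group G] {μ : Set G → ℝ}
    (hadd : ∀ A B : Set G, Disjoint A B → μ (A ∪ B) = μ A + μ B)
    (hright : ∀ (A : Set G) (g : G), μ ((fun x => x * g) '' A) = μ A)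
    {φ : G → G} (hφ : Function.Injective φ) (D : Finset G) (S : Set G)
    (hS : ∀ g ∈ S, g⁻¹ * φ g ∈ D) : μ (φ '' S) = μ S := by
  classical
  induction D using Finset.induction_on generalizing S with
  | empty =>
    obtain rfl : S = ∅ := Set.eq_empty_of_forall_notMem fun g hg => by simpa using hS g hg
    simp
  | insert b D _ ih =>
    set T : Set G := {g | g⁻¹ * φ g = b}
    have hdisj : Disjoint (S ∩ T) (S \ T) := Set.disjoint_sdiff_inter.symm
    have hT : φ '' (S ∩ T) = (fun x => x * b) '' (S ∩ T) :=
      Set.image_congr fun g hg => by rw [← show g⁻¹ * φ g = b from hg.2]; group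
    rw [← Set.inter_union_sdiff S T, Set.image_union, hadd _ _ hdisj,
      hadd _ _ ((Set.disjoint_image_iff hφ).2 hdisj), hT, hright, ih]
    exact fun g hg => (Finset.mem_insert.1 (hS g hg.1)).resolve_left hg.2

/-- If right multiplication by a finite set at least doubles all finite sets, then there is no
right-invariant finitely additive probability measure. -/
theorem not_right_invariant_measure_of_doubling {G : Type*} [Group G] [DecidableEq G]
    (D : Finset G) (hD : ∀ F : Finset G, 2 * F.card ≤ (F * D).card) {μ : Set G → ℝ}
    (hle : ∀ A : Set G, μ A ≤ 1) (huniv : μ Set.univ = 1)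
    (hadd : ∀ A B : Set G, Disjoint A B → μ (A ∪ B) = μ A + μ B)
    (hright : ∀ (A : Set G) (g : G), μ ((fun x => x * g) '' A) = μ A) : False := by
  obtain ⟨f, hf, hfD⟩ := (Finset.all_card_le_biUnion_card_iff_exists_injective
    (fun p : G × Bool => {p.1} * D)).1 fun s => by
      have hs : s ⊆ s.image Prod.fst ×ˢ Finset.univ := fun p hp =>
        Finset.mem_product.2 ⟨Finset.mem_image_of_mem _ hp, Finset.mem_univ _⟩
      have hmul : s.image Prod.fst * D ⊆ s.biUnion fun p => {p.1} * D := fun x hx => by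
        obtain ⟨y, hy, d, hd, rfl⟩ := Finset.mem_mul.1 hx
        obtain ⟨p, hp, rfl⟩ := Finset.mem_image.1 hy
        exact Finset.mem_biUnion.2 ⟨p, hp, Finset.mul_mem_mul (Finset.mem_singleton_self _) hd⟩
      calc s.card ≤ (s.image Prod.fst).card * 2 := by
            simpa [Finset.card_product] using Finset.card_le_card hs
        _ = 2 * (s.image Prod.fst).card := mul_comm _ _
        _ ≤ _ := (hD _).trans (Finset.card_le_card hmul)
  have hrange : ∀ i, μ (Set.range fun g => f (g, i)) = 1 := fun i => by
    rw [← Set.image_univ, measure_image_eq_of_inv_mul_mem hadd hright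
      (fun a b hab => (Prod.mk.inj (hf hab)).1) D, huniv]
    intro g _
    obtain ⟨y, hy, d, hd, h⟩ := Finset.mem_mul.1 (hfD (g, i))
    rw [← h, Finset.mem_singleton.1 hy]
    simpa using hd
  have hdisj : Disjoint (Set.range fun g => f (g, true)) (Set.range fun g => f (g, false)) := by
    rw [Set.disjoint_left]
    rintro _ ⟨a, rfl⟩ ⟨b, hab⟩
    simpa using hf hab
  have h := hle ((Set.range fun g => f (g, true)) ∪ Set.range fun g => f (g, false))
  rw [hadd _ _ hdisj, hrange, hrange] at h
  norm_num at h

/-- Uniform expansion by a factor `c > 1` can be iterated to obtain doubling. -/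
theorem exists_doubling_of_expansion {G : Type*} [Group G] [DecidableEq G] (B : Finset G) {c : ℝ}
    (hc : 1 < c) (hB : ∀ F : Finset G, c * F.card ≤ (F * B).card) :
    ∃ D : Finset G, ∀ F : Finset G, 2 * F.card ≤ (F * D).card := by
  have hpow : ∀ (n : ℕ) (F : Finset G), c ^ n * F.card ≤ (F * B ^ n).card := by
    intro n F
    induction n with
    | zero => simp
    | succ n ih =>
      rw [pow_succ B, ← mul_assoc, pow_succ']
      calc c * c ^ n * F.card = c * (c ^ n * F.card) := mul_assoc _ _ _
        _ ≤ c * (F * B ^ n).card := by gcongr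
        _ ≤ _ := hB _
  obtain ⟨n, hn⟩ := pow_unbounded_of_one_lt 2 hc
  refine ⟨B ^ n, fun F => ?_⟩
  have h : (2 : ℝ) * F.card ≤ (F * B ^ n).card := le_trans (by gcongr) (hpow n F)
  exact_mod_cast h

end

open scoped Pointwise in
/-- Proposition 7.2: a countable group with a proper left-invariant metric is amenable as a
metric space iff it admits a right-invariant finitely additive probability measure defined on
all subsets. -/
theorem amenable_space_iff_right_invariant_measure
    (G : Type*) [Group G] [Countable G] [MetricSpace G]
    (hinv : LeftInvariantMetric G) (hproper : ProperMetric G) :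
    AmenableSpace G ↔
      ∃ μ : Set G → ℝ, (∀ A : Set G, 0 ≤ μ A ∧ μ A ≤ 1) ∧ μ Set.univ = 1 ∧
        (∀ A B : Set G, Disjoint A B → μ (A ∪ B) = μ A + μ B) ∧
        ∀ (A : Set G) (g : G), μ ((fun x => x * g) '' A) = μ A := by
  classical
  constructor
  · intro h
    have hstep : ∀ n : ℕ, (1 : ℝ) < 1 + 1 / ((n : ℝ) + 1) := fun n =>
      lt_add_of_pos_right _ (by positivity)
    choose F hF _ hcard using fun n : ℕ => h _ (hstep n) ((n : ℝ) + 1) (by positivity)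
    refine exists_right_invariant_measure_of_folner F hF fun g => ?_
    obtain ⟨N, hN⟩ := exists_nat_ge (dist g⁻¹ 1)
    filter_upwards [Filter.eventually_ge_atTop N] with n hn A
    have hNn : (N : ℝ) ≤ n := by exact_mod_cast hn
    have hball : ∀ b : G, dist b 1 ≤ (n : ℝ) + 1 → b ∈ (hproper 1 ((n : ℝ) + 1)).toFinset := by
      simp
    have hcardn := hcard n
    rw [hinv.setOf_dist_le_eq_mul hproper, Set.ncard_coe_finset] at hcardn
    set P := F n * (hproper 1 ((n : ℝ) + 1)).toFinset
    have hFP : F n ⊆ P := Finset.subset_mul_left _ (hball 1 (by simpa using by positivity))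
    have hsub : (fun x => x * g⁻¹) '' ((fun x => x * g) '' A ∩ F n) ⊆
        (A ∩ F n) ∪ ((P \ F n : Finset G) : Set G) := by
      rintro _ ⟨_, ⟨⟨a, ha, rfl⟩, hx⟩, rfl⟩
      have hP : a * g * g⁻¹ ∈ P := Finset.mul_mem_mul hx (hball _ (by linarith))
      rw [mul_inv_cancel_right] at hP
      by_cases haF : a ∈ F n <;> simp [ha, haF, hP]
    have hfin : ((A ∩ F n) ∪ ((P \ F n : Finset G) : Set G)).Finite :=
      ((F n).finite_toSet.subset Set.inter_subset_right).union (Finset.finite_toSet _)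
    have hle := (Set.ncard_le_ncard hsub hfin).trans (Set.ncard_union_le _ _)
    rw [Set.ncard_image_of_injective _ (mul_left_injective g⁻¹), Set.ncard_coe_finset] at hle
    have hleR : (((fun x => x * g) '' A ∩ F n).ncard : ℝ) ≤
        (A ∩ F n).ncard + (P \ F n).card := by exact_mod_cast hle
    rw [Finset.cast_card_sdiff hFP] at hleR
    linarith
  · rintro ⟨μ, hbd, huniv, hadd, hright⟩
    by_contra hna
    simp only [AmenableSpace, hinv.setOf_dist_le_eq_mul hproper, Set.ncard_coe_finset,
      Finset.finite_toSet, true_and] at hna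
    push Not at hna
    obtain ⟨c, hc, ε, -, hexp⟩ := hna
    obtain ⟨D, hD⟩ := exists_doubling_of_expansion (hproper 1 ε).toFinset hc fun F => by
      rcases F.eq_empty_or_nonempty with rfl | hF
      · simp
      · exact (hexp F hF).le
    exact not_right_invariant_measure_of_doubling D hD (fun A => (hbd A).2) huniv hadd hright

end
end

section
/- If a homogeneous metric space X is amenable, then for every ε ∈ [0,∞) each ε-connected component of X is an amenable metric space. -/
open scoped ENNReal symmDiff

noncomputable section

theorem comp_eq_comp_iff {X : Type*} [MetricSpace X] {ε : ℝ≥0∞} {x y : X} :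
    comp X ε y = comp X ε x ↔ y ∈ comp X ε x := by
  have symm_rel : Std.Symm (fun a b : X => edist a b ≤ ε) :=
    ⟨fun a b h => by rwa [edist_comm]⟩
  constructor
  · intro h
    rw [← h]
    exact Relation.ReflTransGen.refl
  · intro h
    ext z
    exact ⟨fun hz => Relation.ReflTransGen.trans h hz,
      fun hz => Relation.ReflTransGen.trans (Std.Symm.symm _ _ h) hz⟩

theorem map_mem_comp_of_isometry {X Y : Type*} [MetricSpace X] [MetricSpace Y] {f : X → Y}
    (hf : Isometry f) {ε : ℝ≥0∞} {x y : X} (h : y ∈ comp X ε x) :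
    f y ∈ comp Y ε (f x) :=
  Relation.ReflTransGen.lift (p := fun a b : Y => edist a b ≤ ε) f
    (fun a b hab => (hf a b).trans_le hab) _ _ h

open Classical in
/-- If `|N| ≤ c * |F|` with `F` nonempty, then the same bound holds between the traces of `N` and
`F` on the fibre of any given map through some point of `F`. -/
theorem Finset.exists_card_fiber_le {α β : Type*} {F N : Finset α} (hF : F.Nonempty) {c : ℝ}
    (h : (N.card : ℝ) ≤ c * F.card) (q : α → β) :
    ∃ y ∈ F, ((N.filter (q · = q y)).card : ℝ) ≤ c * (F.filter (q · = q y)).card := by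
  have sum_le : ∑ b ∈ F.image q, ((N.filter (q · = b)).card : ℝ) ≤
      ∑ b ∈ F.image q, c * ((F.filter (q · = b)).card : ℝ) := by
    calc ∑ b ∈ F.image q, ((N.filter (q · = b)).card : ℝ) ≤ N.card := by
          exact_mod_cast (Finset.sum_card_fiberwise_eq_card_filter N (F.image q) q).trans_le
            (Finset.card_filter_le _ _)
      _ ≤ c * F.card := h
      _ = _ := by
          rw [← Finset.mul_sum, Finset.card_eq_sum_card_image q F]
          push_cast
          rfl
  obtain ⟨b, hb, hle⟩ := Finset.exists_le_of_sum_le (hF.image q) sum_le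
  obtain ⟨y, hy, rfl⟩ := Finset.mem_image.1 hb
  exact ⟨y, hy, hle⟩

/-- Proposition 7.3: in an amenable homogeneous metric space every `ε`-connected component
(with the inherited metric) is amenable. -/
theorem components_of_amenable_homogeneous_space_are_amenable
    (X : Type*) [MetricSpace X] (hh : Homogeneous X) (ha : AmenableSpace X) :
    ∀ ε : ℝ≥0∞, ε ≠ ⊤ → ∀ x : X, AmenableSpace ↥(comp X ε x) := by
  classical
  intro ε _ x c hc δ hδ
  obtain ⟨F, hF, hfin, hcard⟩ := ha c hc δ hδ
  rw [Set.ncard_eq_toFinset_card _ hfin] at hcard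
  obtain ⟨y, hy, hle⟩ := Finset.exists_card_fiber_le hF hcard (comp X ε)
  obtain ⟨f, hf⟩ := hh y x
  have symm_x : f.symm x = y := by rw [← hf, f.symm_apply_apply]
  have map_mem {z : X} (hz : comp X ε z = comp X ε y) : f z ∈ comp X ε x :=
    hf ▸ map_mem_comp_of_isometry f.isometry (comp_eq_comp_iff.1 hz)
  have symm_mem {z : X} (hz : z ∈ comp X ε x) : comp X ε (f.symm z) = comp X ε y :=
    comp_eq_comp_iff.2 (symm_x ▸ map_mem_comp_of_isometry f.symm.isometry hz)
  set A := F.filter (comp X ε · = comp X ε y)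
  set B := hfin.toFinset.filter (comp X ε · = comp X ε y)
  set E : Finset (comp X ε x) := (A.image f).subtype (· ∈ comp X ε x)
  have mem_E {z : comp X ε x} : z ∈ E ↔ ∃ a ∈ A, f a = z := by
    simp only [E, Finset.mem_subtype, Finset.mem_image]
  have card_E : E.card = A.card := by
    rw [Finset.card_subtype, Finset.filter_true_of_mem,
      Finset.card_image_of_injective _ f.injective]
    intro z hz
    obtain ⟨a, ha, rfl⟩ := Finset.mem_image.1 hz
    exact map_mem (Finset.mem_filter.1 ha).2
  have maps : Set.MapsTo (fun z : comp X ε x => f.symm z)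
      {z | ∃ w ∈ E, dist z w ≤ δ} (B : Set X) := by
    rintro z ⟨w, hw, hzw⟩
    obtain ⟨a, ha, haw⟩ := mem_E.1 hw
    simp only [B, Finset.coe_filter, Set.mem_ofPred_eq, Set.Finite.mem_toFinset]
    refine ⟨⟨a, (Finset.mem_filter.1 ha).1, ?_⟩, symm_mem z.2⟩
    rwa [← f.isometry.dist_eq, f.apply_symm_apply, haw]
  have inj : Function.Injective (fun z : comp X ε x => f.symm z) :=
    f.symm.injective.comp Subtype.val_injective
  refine ⟨E, ?_, Set.Finite.of_injOn maps inj.injOn B.finite_toSet, ?_⟩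
  · rw [← Finset.card_pos, card_E, Finset.card_pos]
    exact ⟨y, Finset.mem_filter.2 ⟨hy, rfl⟩⟩
  · rw [card_E]
    refine le_trans ?_ hle
    rw [← Set.ncard_coe_finset]
    exact_mod_cast Set.ncard_le_ncard_of_injOn _ maps inj.injOn B.finite_toSet

end
end

section
/- Let X be an amenable metric space and Z a metric space. If A, B are finite subsets of Z and there exists a bijection f : X×Z → X×Z such that f(X×A) = X×B and sup{d(f(x,a),(x,a)) : (x,a) ∈ X×A} < ∞, then |A| = |B|. -/
open scoped ENNReal symmDiff

noncomputable section

/-- If `X` is amenable and `g` maps `X × A` injectively into `X × B`, moving points a uniformly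
bounded distance, then `|A| ≤ |B|`. -/
theorem AmenableSpace.card_le_of_injOn {X Z : Type*} [MetricSpace X] [MetricSpace Z]
    (hX : AmenableSpace X) {A B : Finset Z} {g : X × Z → X × Z}
    (hinj : Set.InjOn g (Set.univ ×ˢ (A : Set Z)))
    (hmaps : Set.MapsTo g (Set.univ ×ˢ (A : Set Z)) (Set.univ ×ˢ (B : Set Z)))
    {M : ℝ} (hM : ∀ p ∈ (Set.univ : Set X) ×ˢ (A : Set Z), dist (g p) p ≤ M) :
    A.card ≤ B.card := by
  have hB : (0 : ℝ) < B.card + 1 := by positivity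
  obtain ⟨F, hF, hfin, hcard⟩ := hX (1 + 1 / (B.card + 1)) (lt_add_of_pos_right 1 (by positivity))
    (max M 1) (by positivity)
  rw [Set.ncard_eq_toFinset_card _ hfin] at hcard
  have hle : (F ×ˢ A).card ≤ (hfin.toFinset ×ˢ B).card := by
    refine Finset.card_le_card_of_injOn g ?_ (hinj.mono ?_)
    · intro p hp
      obtain ⟨hpF, hpA⟩ := Finset.mem_product.1 hp
      have hp' : p ∈ (Set.univ : Set X) ×ˢ (A : Set Z) := ⟨trivial, hpA⟩
      refine Finset.mem_product.2 ⟨hfin.mem_toFinset.2 ⟨p.1, hpF, ?_⟩, (hmaps hp').2⟩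
      exact (le_max_left _ _).trans ((hM p hp').trans (le_max_left _ _))
    · intro p hp
      exact ⟨trivial, (Finset.mem_product.1 hp).2⟩
  rw [Finset.card_product, Finset.card_product] at hle
  have hle' : (F.card : ℝ) * A.card ≤ hfin.toFinset.card * B.card := by exact_mod_cast hle
  have hF' : (0 : ℝ) < F.card := by exact_mod_cast hF.card_pos
  have hA : (A.card : ℝ) ≤ (1 + 1 / (B.card + 1)) * B.card := by
    refine le_of_mul_le_mul_left (hle'.trans ?_) hF'
    calc (hfin.toFinset.card : ℝ) * B.card
        ≤ (1 + 1 / (B.card + 1)) * F.card * B.card := by gcongr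
      _ = F.card * ((1 + 1 / (B.card + 1)) * B.card) := by ring
  have hlt : (1 + 1 / ((B.card : ℝ) + 1)) * B.card < B.card + 1 := by
    have : (B.card : ℝ) / (B.card + 1) < 1 := (div_lt_one hB).2 (lt_add_one _)
    calc (1 + 1 / ((B.card : ℝ) + 1)) * B.card = B.card + B.card / (B.card + 1) := by ring
      _ < B.card + 1 := by gcongr
  exact Nat.lt_succ_iff.1 (by exact_mod_cast hA.trans_lt hlt)

/-- Lemma 7.4: if `X` is amenable and a bijection of `X × Z` carries `X × A` onto `X × B`
(`A, B ⊆ Z` finite) moving the points of `X × A` a uniformly bounded distance, then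
`|A| = |B|`. -/
theorem card_eq_of_bounded_displacement_bijection
    (X Z : Type*) [MetricSpace X] [MetricSpace Z] (hX : AmenableSpace X)
    (A B : Finset Z) (f : X × Z → X × Z) (hbij : Function.Bijective f)
    (him : f '' (Set.univ ×ˢ (A : Set Z)) = Set.univ ×ˢ (B : Set Z))
    (hbd : ∃ M : ℝ, ∀ (x : X), ∀ a ∈ A, dist (f (x, a)) (x, a) ≤ M) :
    A.card = B.card := by
  obtain ⟨M, hM⟩ := hbd
  refine le_antisymm
    (hX.card_le_of_injOn (g := f) (M := M) hbij.1.injOn (Set.mapsTo_iff_image_subset.2 him.le) ?_)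
    (hX.card_le_of_injOn (g := (Equiv.ofBijective f hbij).symm) (M := M)
      (Equiv.injective _).injOn ?_ ?_)
  · rintro ⟨x, a⟩ ⟨-, ha⟩
    exact hM x a ha
  · rw [← him]
    rintro _ ⟨p, hp, rfl⟩
    rwa [Equiv.ofBijective_symm_apply_apply]
  · rw [← him]
    rintro _ ⟨⟨x, a⟩, ⟨-, ha⟩, rfl⟩
    rw [Equiv.ofBijective_symm_apply_apply, dist_comm]
    exact hM x a ha

end
end
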